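/- Let σ1 be the Tribonacci substitution on the alphabet {a,b,c} given by σ1(a)=ab, σ1(b)=ac, σ1(c)=a, and let σ2 be the flipped Tribonacci substitution given by σ2(a)=ab, σ2(b)=ca, σ2(c)=a. Let U and V be the fixed points (infinite words) of σ1 and σ2 beginning with the letter a. Then the letter c never occurs at the same position in U and V: for every n ∈ ℕ, it is not the case that U_n = c and V_n = c. -/

import Mathlib

/- STATEMENT 6: The letter c never occurs at the same position in the fixed
points of the Tribonacci and flipped Tribonacci substitutions. -/

namespace Stmt6

inductive ABC : Type
  | a | b | c
deriving DecidableEq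

/-- Extension of a substitution (letter → word) to finite words. -/
def subst (σ : ABC → List ABC) (w : List ABC) : List ABC :=
  w.flatMap σ

/-- The Tribonacci substitution. -/
def σ1 : ABC → List ABC
  | .a => [.a, .b]
  | .b => [.a, .c]
  | .c => [.a]

/-- The flipped Tribonacci substitution. -/
def σ2 : ABC → List ABC
  | .a => [.a, .b]
  | .b => [.c, .a]
  | .c => [.a]

/-- `w` is a (finite) prefix of the infinite word `u`. -/
def IsPrefixOf (w : List ABC) (u : ℕ → ABC) : Prop :=
  (List.range w.length).map u = w

/-- `u` is a fixed point of `σ` beginning with the letter `x`. -/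
def IsFixedPointOf (σ : ABC → List ABC) (x : ABC) (u : ℕ → ABC) : Prop :=
  ∀ k : ℕ, IsPrefixOf ((subst σ)^[k] [x]) u

/-- The irreducible balanced pairs generated by the pair `(a, a)` under `(σ1, σ2)`. The constructor
`pu_v` stands for the pair of words `(u, v)`. -/
inductive BalancedPair : Type
  | pa_a
  | pb_b
  | pac_ca
  | pba_ab
  | pcab_bca
  | paabac_caaab
  | pcab_abc
  | pabac_bcaa
  | pabaca_caaab
  | pcabaab_ababca
  | pababac_bcaaab

namespace BalancedPair

/-- The first word of a balanced pair. -/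
def top : BalancedPair → List ABC
  | .pa_a => [.a]
  | .pb_b => [.b]
  | .pac_ca => [.a, .c]
  | .pba_ab => [.b, .a]
  | .pcab_bca => [.c, .a, .b]
  | .paabac_caaab => [.a, .a, .b, .a, .c]
  | .pcab_abc => [.c, .a, .b]
  | .pabac_bcaa => [.a, .b, .a, .c]
  | .pabaca_caaab => [.a, .b, .a, .c, .a]
  | .pcabaab_ababca => [.c, .a, .b, .a, .a, .b]
  | .pababac_bcaaab => [.a, .b, .a, .b, .a, .c]

/-- The second word of a balanced pair. -/
def bottom : BalancedPair → List ABC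
  | .pa_a => [.a]
  | .pb_b => [.b]
  | .pac_ca => [.c, .a]
  | .pba_ab => [.a, .b]
  | .pcab_bca => [.b, .c, .a]
  | .paabac_caaab => [.c, .a, .a, .a, .b]
  | .pcab_abc => [.a, .b, .c]
  | .pabac_bcaa => [.b, .c, .a, .a]
  | .pabaca_caaab => [.c, .a, .a, .a, .b]
  | .pcabaab_ababca => [.a, .b, .a, .b, .c, .a]
  | .pababac_bcaaab => [.b, .c, .a, .a, .a, .b]

/-- The decomposition into balanced pairs of the image of a balanced pair under `(σ1, σ2)`. -/
def image : BalancedPair → List BalancedPair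
  | .pa_a => [.pa_a, .pb_b]
  | .pb_b => [.pac_ca]
  | .pac_ca => [.pa_a, .pba_ab]
  | .pba_ab => [.pa_a, .pcab_bca]
  | .pcab_bca => [.paabac_caaab]
  | .paabac_caaab => [.pa_a, .pba_ab, .pba_ab, .pcab_abc, .pa_a]
  | .pcab_abc => [.pa_a, .pabac_bcaa]
  | .pabac_bcaa => [.pabaca_caaab, .pba_ab]
  | .pabaca_caaab => [.pa_a, .pba_ab, .pcabaab_ababca]
  | .pcabaab_ababca => [.pa_a, .pabac_bcaa, .pababac_bcaaab]
  | .pababac_bcaaab => [.pabaca_caaab, .pba_ab, .pcab_abc, .pa_a]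

theorem subst_top (B : BalancedPair) : subst σ1 B.top = B.image.flatMap top := by
  cases B <;> rfl

theorem subst_bottom (B : BalancedPair) : subst σ2 B.bottom = B.image.flatMap bottom := by
  cases B <;> rfl

theorem length_top_eq (B : BalancedPair) : B.top.length = B.bottom.length := by
  cases B <;> rfl

theorem cc_notMem_zip (B : BalancedPair) : (ABC.c, ABC.c) ∉ B.top.zip B.bottom := by
  cases B <;> decide

theorem length_flatMap_top_eq (L : List BalancedPair) :
    (L.flatMap top).length = (L.flatMap bottom).length := by
  simp [List.length_flatMap, length_top_eq]

theorem cc_notMem_zip_flatMap (L : List BalancedPair) :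
    (ABC.c, ABC.c) ∉ (L.flatMap top).zip (L.flatMap bottom) := by
  induction L with
  | nil => simp
  | cons B L ih =>
    rw [List.flatMap_cons, List.flatMap_cons, List.zip_append B.length_top_eq, List.mem_append]
    exact not_or.mpr ⟨B.cc_notMem_zip, ih⟩

end BalancedPair

/-- A decomposition of words into blocks that is compatible with a substitution is compatible with
its iterates. -/
theorem iterate_subst_flatMap {β : Type*} {σ : ABC → List ABC} {f : β → List ABC}
    {g : β → List β} (h : ∀ B, subst σ (f B) = (g B).flatMap f) (k : ℕ) (L : List β) :
    (subst σ)^[k] (L.flatMap f) = ((fun M => M.flatMap g)^[k] L).flatMap f := by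
  refine (Function.Semiconj.iterate_right (f := fun M : List β => M.flatMap f)
    (fun M => ?_) k L).symm
  simp only [subst, List.flatMap_assoc] at h ⊢
  simp only [h]

theorem length_le_length_subst_σ1 (w : List ABC) : w.length ≤ (subst σ1 w).length := by
  induction w with
  | nil => simp
  | cons x w ih =>
    have hx : 1 ≤ (σ1 x).length := by cases x <;> decide
    rw [subst] at ih ⊢
    rw [List.flatMap_cons, List.length_append, List.length_cons]
    omega

theorem lt_length_iterate_subst_σ1 (k : ℕ) : k < ((subst σ1)^[k] [.a]).length := by
  suffices h : ∃ t, (subst σ1)^[k] [.a] = .a :: t ∧ k ≤ t.length by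
    obtain ⟨t, ht, hk⟩ := h
    simpa [ht] using Nat.lt_succ_of_le hk
  induction k with
  | zero => exact ⟨[], rfl, le_rfl⟩
  | succ k ih =>
    obtain ⟨t, ht, hk⟩ := ih
    refine ⟨.b :: subst σ1 t, ?_, ?_⟩
    · rw [Function.iterate_succ_apply', ht]
      rfl
    · simpa using hk.trans (length_le_length_subst_σ1 t)

theorem IsPrefixOf.getElem_eq {w : List ABC} {u : ℕ → ABC} (h : IsPrefixOf w u) {n : ℕ}
    (hn : n < w.length) : w[n] = u n := by
  rw [IsPrefixOf] at h
  have := List.getElem_of_eq h (i := n) (by simpa using hn)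
  simpa using this.symm

theorem c_never_same_position
    (U V : ℕ → ABC)
    (hU : IsFixedPointOf σ1 .a U) (hV : IsFixedPointOf σ2 .a V) :
    ∀ n : ℕ, ¬(U n = ABC.c ∧ V n = ABC.c) := by
  rintro n ⟨hUn, hVn⟩
  set L := (fun M => M.flatMap BalancedPair.image)^[n] [.pa_a]
  have h_top : (subst σ1)^[n] [.a] = L.flatMap BalancedPair.top :=
    iterate_subst_flatMap BalancedPair.subst_top n [.pa_a]
  have h_bot : (subst σ2)^[n] [.a] = L.flatMap BalancedPair.bottom :=
    iterate_subst_flatMap BalancedPair.subst_bottom n [.pa_a]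
  have h_len : n < (L.flatMap BalancedPair.top).length := h_top ▸ lt_length_iterate_subst_σ1 n
  have h_len' : n < (L.flatMap BalancedPair.bottom).length :=
    BalancedPair.length_flatMap_top_eq L ▸ h_len
  have hU' : (L.flatMap BalancedPair.top)[n] = .c :=
    (IsPrefixOf.getElem_eq (h_top ▸ hU n) h_len).trans hUn
  have hV' : (L.flatMap BalancedPair.bottom)[n] = .c :=
    (IsPrefixOf.getElem_eq (h_bot ▸ hV n) h_len').trans hVn
  refine BalancedPair.cc_notMem_zip_flatMap L (List.mem_iff_getElem.mpr ⟨n, ?_, ?_⟩)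
  · exact List.length_zip ▸ lt_min h_len h_len'
  · rw [List.getElem_zip, hU', hV']

end Stmt6
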